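/- arXiv:1801.00382 — 3 statements merged into one kernel-verified Lean document; each statement's English description precedes it below -/
import Mathlib

section
/- Let k ≥ 2, let h₁, …, h_k ∈ V, let ⟨·,·⟩ be a positive semidefinite symmetric bilinear form on V with semi-norm ‖·‖, and suppose ‖h_j‖ = 1 for j = 1, …, k. Let θ₂, …, θ_k ∈ [0,1] with Σ_{j=2}^k θ_j = 1, set g = Σ_{j=2}^k θ_j h_j and s = Σ_{j=2}^k h_j, and define r(g) = g − ⟨g, h₁⟩h₁ and r(s) = s − ⟨s, h₁⟩h₁. For λ > 0 define T(λ) = ⟨λh₁ + g, s⟩ / ‖λh₁ + g‖ and T(∞) = ⟨h₁, s⟩. If ⟨h_j, h₁⟩ ≥ 0 for every j = 2, …, k, ⟨r(g), r(s)⟩ > 0, λ > 0, and λ ≥ (‖r(g)‖² ⟨s, h₁⟩² − ⟨r(g), r(s)⟩²) / (2 ⟨s, h₁⟩ ⟨r(g), r(s)⟩) − ⟨g, h₁⟩, then T(λ) ≥ T(∞). -/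
open MeasureTheory

/-- `V = L²[0,1]`. -/
noncomputable abbrev V := Lp ℝ 2 (volume : Measure (Set.Icc (0:ℝ) 1))

/-- The semi-norm induced by a bilinear form `B` on `V`: `‖x‖_B = √(B x x)`. -/
noncomputable def bnorm (B : V →ₗ[ℝ] V →ₗ[ℝ] ℝ) (x : V) : ℝ := Real.sqrt (B x x)

/-- Fact 2: with `g = Σ θⱼ hⱼ`, `s = Σ hⱼ`, `r(g) = g − ⟨g,h₁⟩h₁`,
`r(s) = s − ⟨s,h₁⟩h₁`, if `⟨hⱼ, h₁⟩ ≥ 0` for `j ≥ 2`, `⟨r(g), r(s)⟩ > 0`, `λ > 0`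
and `λ ≥ (‖r(g)‖²⟨s,h₁⟩² − ⟨r(g),r(s)⟩²)/(2⟨s,h₁⟩⟨r(g),r(s)⟩) − ⟨g,h₁⟩`,
then `T(λ) ≥ T(∞)`. -/
theorem stmt_1 (k : ℕ) (hk : 2 ≤ k) (h : ℕ → V)
    (B : V →ₗ[ℝ] V →ₗ[ℝ] ℝ)
    (hsym : ∀ x y : V, B x y = B y x)
    (hpsd : ∀ x : V, 0 ≤ B x x)
    (hnorm : ∀ j ∈ Finset.Icc 1 k, bnorm B (h j) = 1)
    (θ : ℕ → ℝ) (hθ : ∀ j ∈ Finset.Icc 2 k, θ j ∈ Set.Icc (0 : ℝ) 1)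
    (hθsum : ∑ j ∈ Finset.Icc 2 k, θ j = 1)
    (g : V) (hg : g = ∑ j ∈ Finset.Icc 2 k, θ j • h j)
    (s : V) (hs : s = ∑ j ∈ Finset.Icc 2 k, h j)
    (rg : V) (hrg : rg = g - B g (h 1) • h 1)
    (rs : V) (hrs : rs = s - B s (h 1) • h 1)
    (hpos : ∀ j ∈ Finset.Icc 2 k, 0 ≤ B (h j) (h 1))
    (hrgrs : 0 < B rg rs)
    (lam : ℝ) (hlam : 0 < lam)
    (hlam2 : lam ≥ ((bnorm B rg) ^ 2 * (B s (h 1)) ^ 2 - (B rg rs) ^ 2) /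
        (2 * B s (h 1) * B rg rs) - B g (h 1)) :
    B (lam • h 1 + g) s / bnorm B (lam • h 1 + g) ≥ B (h 1) s := by
  have h_unit : B (h 1) (h 1) = 1 := by
    have h1 := hnorm 1 (Finset.mem_Icc.mpr ⟨le_rfl, by omega⟩)
    rwa [bnorm, Real.sqrt_eq_one] at h1
  have hs_nonneg : 0 ≤ B s (h 1) := by
    rw [hs, map_sum, LinearMap.sum_apply]
    exact Finset.sum_nonneg hpos
  have hg_nonneg : 0 ≤ B g (h 1) := by
    rw [hg, map_sum, LinearMap.sum_apply]
    refine Finset.sum_nonneg fun j hj => ?_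
    rw [map_smul, LinearMap.smul_apply, smul_eq_mul]
    exact mul_nonneg (hθ j hj).1 (hpos j hj)
  have h_cross : B rg rs = B g s - B g (h 1) * B s (h 1) := by
    simp only [hrg, hrs, map_sub, map_smul, LinearMap.sub_apply, LinearMap.smul_apply,
      smul_eq_mul, h_unit, hsym (h 1) s]
    ring
  have h_rg : B rg rg = B g g - B g (h 1) ^ 2 := by
    simp only [hrg, map_sub, map_smul, LinearMap.sub_apply, LinearMap.smul_apply,
      smul_eq_mul, h_unit, hsym (h 1) g]
    ring
  have h_num : B (lam • h 1 + g) s = (lam + B g (h 1)) * B s (h 1) + B rg rs := by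
    simp only [map_add, map_smul, LinearMap.add_apply, LinearMap.smul_apply, smul_eq_mul,
      h_cross, hsym (h 1) s]
    ring
  have h_sq : B (lam • h 1 + g) (lam • h 1 + g) = (lam + B g (h 1)) ^ 2 + B rg rg := by
    simp only [map_add, map_smul, LinearMap.add_apply, LinearMap.smul_apply, smul_eq_mul,
      h_rg, h_unit, hsym (h 1) g]
    ring
  have h_rg_nonneg := hpsd rg
  have h_bnorm : bnorm B rg ^ 2 = B rg rg := Real.sq_sqrt h_rg_nonneg
  rw [h_bnorm] at hlam2
  rw [ge_iff_le, hsym (h 1) s, h_num, bnorm, h_sq]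
  generalize B s (h 1) = a at *
  generalize B g (h 1) = b at *
  generalize B rg rs = c at *
  generalize B rg rg = n at *
  have hμ : 0 < lam + b := by linarith
  rw [le_div_iff₀ (Real.sqrt_pos.mpr (by positivity))]
  rcases hs_nonneg.eq_or_lt with ha | ha
  · simp [← ha, hrgrs.le]
  · have h_bound : n * a ^ 2 - c ^ 2 ≤ (lam + b) * (2 * a * c) := by
      rw [← div_le_iff₀ (by positivity)]
      linarith
    refine abs_le_of_sq_le_sq' ?_ (by positivity) |>.2
    rw [mul_pow, Real.sq_sqrt (by positivity)]
    nlinarith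
end

section
/- Assume conditions (C1)–(C6) hold, that ‖f_j∘ψ_j‖ > 0 and ‖f₁‖_j > 0 for 2 ≤ j ≤ k, that for each j = 2, …, k the supremum ρ(f₁, f_j) is attained at ψ_j, i.e. ρ(f₁, f_j) = ρ(f₁, f_j | ψ_j), and that for each j the set {ρ(f₁*, f_j | ψ) : ψ ∈ 𝓜} is bounded above. Then Σ_{j=2}^k ρ(f₁*, f_j) ≥ Σ_{j=2}^k ρ(f₁, f_j). -/
noncomputable section

/-- `Ef = ∫₀¹ f(x) dx`. -/
def Emean (f : ℝ → ℝ) : ℝ := ∫ x in (0:ℝ)..1, f x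

/-- The centered inner product `⟨f, g⟩ = ∫₀¹ (f(x) − Ef)(g(x) − Eg) dx`. -/
def cinner (f g : ℝ → ℝ) : ℝ := ∫ x in (0:ℝ)..1, (f x - Emean f) * (g x - Emean g)

/-- The semi-norm `‖f‖ = √⟨f, f⟩`. -/
def cnorm (f : ℝ → ℝ) : ℝ := Real.sqrt (cinner f f)

/-- The similarity `r(f, g) = ⟨f, g⟩ / (‖f‖ ‖g‖)`. -/
def csim (f g : ℝ → ℝ) : ℝ := cinner f g / (cnorm f * cnorm g)

/-- The space `𝓜` of warping functions: continuously differentiable strictly increasing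
functions `ψ : [0,1] → [0,1]` with `ψ(0) = 0`, `ψ(1) = 1` whose inverse is also
continuously differentiable.  The inverse is carried explicitly. -/
structure Warp where
  toFun : ℝ → ℝ
  invFun : ℝ → ℝ
  maps_to : ∀ t ∈ Set.Icc (0:ℝ) 1, toFun t ∈ Set.Icc (0:ℝ) 1
  strictMono : StrictMonoOn toFun (Set.Icc (0:ℝ) 1)
  diff : ∀ t ∈ Set.Icc (0:ℝ) 1, DifferentiableAt ℝ toFun t
  deriv_cont : ContinuousOn (deriv toFun) (Set.Icc (0:ℝ) 1)
  map_zero : toFun 0 = 0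
  map_one : toFun 1 = 1
  inv_maps_to : ∀ t ∈ Set.Icc (0:ℝ) 1, invFun t ∈ Set.Icc (0:ℝ) 1
  left_inv : ∀ t ∈ Set.Icc (0:ℝ) 1, invFun (toFun t) = t
  right_inv : ∀ t ∈ Set.Icc (0:ℝ) 1, toFun (invFun t) = t
  inv_diff : ∀ t ∈ Set.Icc (0:ℝ) 1, DifferentiableAt ℝ invFun t
  inv_deriv_cont : ContinuousOn (deriv invFun) (Set.Icc (0:ℝ) 1)

/-- `E_ψ f = ∫₀¹ f(t) ψ′(t) dt`. -/
def wE (ψ : ℝ → ℝ) (f : ℝ → ℝ) : ℝ := ∫ t in (0:ℝ)..1, f t * deriv ψ t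

/-- `⟨f, g⟩_ψ = ∫₀¹ (f(t) − E_ψ f)(g(t) − E_ψ g) ψ′(t) dt`. -/
def winner (ψ : ℝ → ℝ) (f g : ℝ → ℝ) : ℝ :=
  ∫ t in (0:ℝ)..1, (f t - wE ψ f) * (g t - wE ψ g) * deriv ψ t

/-- `‖f‖_ψ = √⟨f, f⟩_ψ`. -/
def wnorm (ψ : ℝ → ℝ) (f : ℝ → ℝ) : ℝ := Real.sqrt (winner ψ f f)

/-- `ρ*(f, g | ψ) = r(f, g∘ψ) − l₀ ∫₀¹ (ψ′(t) − 1)² dt`. -/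
def rhoStar (l₀ : ℝ) (f g : ℝ → ℝ) (ψ : ℝ → ℝ) : ℝ :=
  csim f (g ∘ ψ) - l₀ * ∫ t in (0:ℝ)..1, (deriv ψ t - 1) ^ 2

/-- `ρ(f, g | ψ) = (ρ*(f, g | ψ) + ρ*(g, f | ψ⁻¹))/2`. -/
def rhoW (l₀ : ℝ) (f g : ℝ → ℝ) (w : Warp) : ℝ :=
  (rhoStar l₀ f g w.toFun + rhoStar l₀ g f w.invFun) / 2

/-- The similarity measure `ρ(f, g) = sup_{ψ ∈ 𝓜} ρ(f, g | ψ)`. -/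
def rhoSim (l₀ : ℝ) (f g : ℝ → ℝ) : ℝ := ⨆ w : Warp, rhoW l₀ f g w


/-! ### The weighted centered inner product -/

/-- The conditions on `ψ` under which `winner ψ` is a positive semi-definite symmetric
bilinear form on continuous functions. -/
structure NonnegContDeriv (ψ : ℝ → ℝ) : Prop where
  cont : ContinuousOn (deriv ψ) (Set.Icc (0:ℝ) 1)
  nonneg : ∀ t ∈ Set.Icc (0:ℝ) 1, 0 ≤ deriv ψ t

theorem NonnegContDeriv.id : NonnegContDeriv (fun t => t) where
  cont := by simpa using continuousOn_const
  nonneg := by simp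

theorem Warp.continuousOn (w : Warp) : ContinuousOn w.toFun (Set.Icc 0 1) :=
  fun t ht => (w.diff t ht).continuousAt.continuousWithinAt

theorem Warp.continuousOn_inv (w : Warp) : ContinuousOn w.invFun (Set.Icc 0 1) :=
  fun t ht => (w.inv_diff t ht).continuousAt.continuousWithinAt

theorem Warp.nonnegContDeriv (w : Warp) : NonnegContDeriv w.toFun where
  cont := w.deriv_cont
  nonneg t ht := by
    rw [← (w.diff t ht).derivWithin (uniqueDiffOn_Icc zero_lt_one t ht)]
    exact w.strictMono.monotoneOn.derivWithin_nonneg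

theorem intervalIntegrable_of_continuousOn_Icc {f : ℝ → ℝ}
    (hf : ContinuousOn f (Set.Icc (0:ℝ) 1)) : IntervalIntegrable f MeasureTheory.volume 0 1 :=
  ContinuousOn.intervalIntegrable (by rwa [Set.uIcc_of_le zero_le_one])

theorem cinner_eq_winner (f g : ℝ → ℝ) : cinner f g = winner (fun t => t) f g := by
  simp [cinner, winner, Emean, wE]

theorem cnorm_eq_wnorm (f : ℝ → ℝ) : cnorm f = wnorm (fun t => t) f := by
  simp [cnorm, wnorm, cinner_eq_winner]

theorem winner_comm (ψ f g : ℝ → ℝ) : winner ψ f g = winner ψ g f := by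
  simp only [winner]
  congr 1
  ext t
  ring

theorem wnorm_nonneg (ψ f : ℝ → ℝ) : 0 ≤ wnorm ψ f := Real.sqrt_nonneg _

section Bilinear

variable {ψ f g h : ℝ → ℝ}

theorem wE_lincomb (hψ : NonnegContDeriv ψ) (hf : ContinuousOn f (Set.Icc 0 1))
    (hg : ContinuousOn g (Set.Icc 0 1)) (a b : ℝ) :
    wE ψ (fun t => a * f t + b * g t) = a * wE ψ f + b * wE ψ g := by
  have hc := hψ.cont
  unfold wE
  rw [← intervalIntegral.integral_const_mul, ← intervalIntegral.integral_const_mul,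
    ← intervalIntegral.integral_add
      (intervalIntegrable_of_continuousOn_Icc (by fun_prop))
      (intervalIntegrable_of_continuousOn_Icc (by fun_prop))]
  congr 1
  ext t
  ring

theorem winner_lincomb_left (hψ : NonnegContDeriv ψ) (hf : ContinuousOn f (Set.Icc 0 1))
    (hg : ContinuousOn g (Set.Icc 0 1)) (hh : ContinuousOn h (Set.Icc 0 1)) (a b : ℝ) :
    winner ψ (fun t => a * f t + b * g t) h = a * winner ψ f h + b * winner ψ g h := by
  have hc := hψ.cont
  unfold winner
  rw [wE_lincomb hψ hf hg, ← intervalIntegral.integral_const_mul,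
    ← intervalIntegral.integral_const_mul, ← intervalIntegral.integral_add
      (intervalIntegrable_of_continuousOn_Icc (by fun_prop))
      (intervalIntegrable_of_continuousOn_Icc (by fun_prop))]
  congr 1
  ext t
  ring

theorem winner_lincomb_right (hψ : NonnegContDeriv ψ) (hf : ContinuousOn f (Set.Icc 0 1))
    (hg : ContinuousOn g (Set.Icc 0 1)) (hh : ContinuousOn h (Set.Icc 0 1)) (a b : ℝ) :
    winner ψ h (fun t => a * f t + b * g t) = a * winner ψ h f + b * winner ψ h g := by
  rw [winner_comm, winner_lincomb_left hψ hf hg hh, winner_comm ψ f, winner_comm ψ g]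

theorem winner_lincomb_self (hψ : NonnegContDeriv ψ) (hf : ContinuousOn f (Set.Icc 0 1))
    (hg : ContinuousOn g (Set.Icc 0 1)) (a b : ℝ) :
    winner ψ (fun t => a * f t + b * g t) (fun t => a * f t + b * g t) =
      a ^ 2 * winner ψ f f + 2 * a * b * winner ψ f g + b ^ 2 * winner ψ g g := by
  rw [winner_lincomb_left hψ hf hg (by fun_prop), winner_lincomb_right hψ hf hg hf,
    winner_lincomb_right hψ hf hg hg, winner_comm ψ g f]
  ring

theorem winner_sum_left {ι : Type*} (S : Finset ι) (hψ : NonnegContDeriv ψ) {G : ι → ℝ → ℝ}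
    (hG : ∀ i ∈ S, ContinuousOn (G i) (Set.Icc 0 1)) (hh : ContinuousOn h (Set.Icc 0 1))
    (c : ι → ℝ) :
    winner ψ (fun t => ∑ i ∈ S, c i * G i t) h = ∑ i ∈ S, c i * winner ψ (G i) h := by
  classical
  induction S using Finset.induction_on with
  | empty => simp [winner, wE]
  | insert i S hi ih =>
    have hS : ∀ j ∈ S, ContinuousOn (G j) (Set.Icc 0 1) :=
      fun j hj => hG j (Finset.mem_insert_of_mem hj)
    have key := winner_lincomb_left hψ (hG i (Finset.mem_insert_self i S))
      (continuousOn_finsetSum S fun j hj => (hS j hj).const_mul (c j)) hh (c i) 1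
    simp only [one_mul] at key
    simp only [Finset.sum_insert hi]
    rw [← ih hS, ← key]

theorem winner_self_nonneg (hψ : NonnegContDeriv ψ) (f : ℝ → ℝ) : 0 ≤ winner ψ f f :=
  intervalIntegral.integral_nonneg zero_le_one fun t ht =>
    mul_nonneg (mul_self_nonneg _) (hψ.nonneg t ht)

theorem wnorm_sq (hψ : NonnegContDeriv ψ) (f : ℝ → ℝ) : wnorm ψ f ^ 2 = winner ψ f f :=
  Real.sq_sqrt (winner_self_nonneg hψ f)

theorem abs_winner_le (hψ : NonnegContDeriv ψ) (hf : ContinuousOn f (Set.Icc 0 1))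
    (hg : ContinuousOn g (Set.Icc 0 1)) : |winner ψ f g| ≤ wnorm ψ f * wnorm ψ g := by
  have hd : discrim (winner ψ g g) (2 * winner ψ f g) (winner ψ f f) ≤ 0 := by
    refine discrim_le_zero fun x => ?_
    have := winner_self_nonneg hψ (fun t => 1 * f t + x * g t)
    rw [winner_lincomb_self hψ hf hg] at this
    linarith
  refine abs_le_of_sq_le_sq ?_ (mul_nonneg (wnorm_nonneg ψ f) (wnorm_nonneg ψ g))
  rw [mul_pow, wnorm_sq hψ, wnorm_sq hψ]
  unfold discrim at hd
  linarith

end Bilinear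

/-! ### Change of variables along a warping function -/

theorem Warp.integral_comp_mul_deriv (w : Warp) {G : ℝ → ℝ} (hG : ContinuousOn G (Set.Icc 0 1)) :
    ∫ t in (0:ℝ)..1, G (w.toFun t) * deriv w.toFun t = ∫ u in (0:ℝ)..1, G u := by
  have h01 : Set.uIcc (0:ℝ) 1 = Set.Icc 0 1 := Set.uIcc_of_le zero_le_one
  have := intervalIntegral.integral_comp_mul_deriv''' (a := 0) (b := 1) (f := w.toFun)
    (f' := deriv w.toFun) (g := G) (by rw [h01]; exact w.continuousOn)
    (fun x hx => (w.diff x ?_).hasDerivAt.hasDerivWithinAt) ?_ ?_ ?_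
  · simpa [w.map_zero, w.map_one] using this
  · rw [min_eq_left zero_le_one, max_eq_right zero_le_one] at hx
    exact ⟨hx.1.le, hx.2.le⟩
  · refine hG.mono ?_
    rw [min_eq_left zero_le_one, max_eq_right zero_le_one]
    rintro _ ⟨t, ht, rfl⟩
    exact w.maps_to t ⟨ht.1.le, ht.2.le⟩
  · rw [h01]
    refine (hG.mono ?_).integrableOn_compact (isCompact_Icc.image_of_continuousOn w.continuousOn)
    rintro _ ⟨t, ht, rfl⟩
    exact w.maps_to t ht
  · rw [h01]
    exact ((hG.comp w.continuousOn w.maps_to).mul w.deriv_cont).integrableOn_compact isCompact_Icc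

theorem Warp.emean_eq (w : Warp) {f g : ℝ → ℝ} (hf : ContinuousOn f (Set.Icc 0 1))
    (hfg : ∀ t ∈ Set.Icc (0:ℝ) 1, f (w.toFun t) = g t) : Emean f = wE w.toFun g := by
  rw [Emean, ← w.integral_comp_mul_deriv hf, wE]
  refine intervalIntegral.integral_congr fun t ht => ?_
  rw [Set.uIcc_of_le zero_le_one] at ht
  simp only [hfg t ht]

theorem Warp.cinner_eq (w : Warp) {f₁ f₂ g₁ g₂ : ℝ → ℝ} (hf₁ : ContinuousOn f₁ (Set.Icc 0 1))
    (hf₂ : ContinuousOn f₂ (Set.Icc 0 1))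
    (h₁ : ∀ t ∈ Set.Icc (0:ℝ) 1, f₁ (w.toFun t) = g₁ t)
    (h₂ : ∀ t ∈ Set.Icc (0:ℝ) 1, f₂ (w.toFun t) = g₂ t) :
    cinner f₁ f₂ = winner w.toFun g₁ g₂ := by
  rw [cinner, ← w.integral_comp_mul_deriv (by fun_prop), winner, w.emean_eq hf₁ h₁,
    w.emean_eq hf₂ h₂]
  refine intervalIntegral.integral_congr fun t ht => ?_
  rw [Set.uIcc_of_le zero_le_one] at ht
  simp only [h₁ t ht, h₂ t ht]

theorem Warp.csim_comp_inv (w : Warp) {f g : ℝ → ℝ} (hf : ContinuousOn f (Set.Icc 0 1))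
    (hg : ContinuousOn g (Set.Icc 0 1)) (hg1 : cnorm g = 1) :
    csim g (f ∘ w.invFun) = winner w.toFun f (g ∘ w.toFun) / wnorm w.toFun f := by
  have hfi : ContinuousOn (f ∘ w.invFun) (Set.Icc 0 1) :=
    hf.comp w.continuousOn_inv w.inv_maps_to
  have hinv : ∀ t ∈ Set.Icc (0:ℝ) 1, (f ∘ w.invFun) (w.toFun t) = f t := fun t ht => by
    simp [w.left_inv t ht]
  rw [csim, hg1, one_mul, cnorm, w.cinner_eq hfi hfi hinv hinv,
    w.cinner_eq (g₁ := g ∘ w.toFun) hg hfi (fun _ _ => rfl) hinv, winner_comm, wnorm]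

theorem Warp.wnorm_comp (w : Warp) {g : ℝ → ℝ} (hg : ContinuousOn g (Set.Icc 0 1)) :
    wnorm w.toFun (g ∘ w.toFun) = cnorm g := by
  rw [wnorm, cnorm, w.cinner_eq hg hg (fun _ _ => rfl) (fun _ _ => rfl)]
  rfl

/-! ### Scalar inequalities -/

theorem mul_sqrt_le_of_le {a p q H l : ℝ} (ha : 0 ≤ a) (hq : 0 < q) (hlp : 0 ≤ l + p)
    (hl : (H * a ^ 2 - q ^ 2) / (2 * a * q) - p ≤ l) :
    a * √((l + p) ^ 2 + H) ≤ (l + p) * a + q := by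
  rcases ha.eq_or_lt with rfl | ha
  · simpa using hq.le
  have h1 : H * a ^ 2 - q ^ 2 ≤ (l + p) * (2 * a * q) := by
    rw [← div_le_iff₀ (by positivity)]
    linarith
  rw [← le_div_iff₀' ha]
  refine Real.sqrt_le_iff.mpr ⟨by positivity, ?_⟩
  rw [div_pow, le_div_iff₀ (by positivity)]
  nlinarith

theorem two_lt_three_div_sqrt_two : 2.12 < 3 / √2 := by
  rw [lt_div_iff₀ (by positivity)]
  have : √2 < 1.415 := (Real.sqrt_lt' (by norm_num)).mpr (by norm_num)
  linarith

/-- A quadratic lower bound for `(A + b) / √(1 + δ + e²)` about `δ = e = 0`.  Beyond the radius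
where the Taylor remainder is controlled, the right-hand side is at most `-1`. -/
theorem lincomb_div_sqrt_ge {A b δ e : ℝ} (he0 : 0 ≤ e) (he1 : e ≤ 1) (hb1 : |b| ≤ 1)
    (hbe : |b| ≤ e) (hδ : |δ| ≤ 2 * e) (hT : -1 ≤ (A + b) / √(1 + δ + e ^ 2)) :
    A + (b - 1 / 2 * A * δ) - (1 / 2 * (A * e ^ 2 + b * δ + |b| * e) +
      3 / √2 * (|A| + 1) * (|δ| + e) ^ 2) ≤ (A + b) / √(1 + δ + e ^ 2) := by
  have hc := two_lt_three_div_sqrt_two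
  set c := 3 / √2
  have hA0 := abs_nonneg A
  rcases le_total (1 / 2) (1 + δ + e ^ 2) with hn | hn
  · obtain ⟨v, hv⟩ : ∃ v, v = √(1 + δ + e ^ 2) := ⟨_, rfl⟩
    have hvsq : v ^ 2 = 1 + δ + e ^ 2 := by rw [hv]; exact Real.sq_sqrt (by linarith)
    have hv7 : 0.7 ≤ v := by rw [hv]; exact Real.le_sqrt_of_sq_le (by linarith)
    have hv0 : 0 < v := by linarith
    rw [← hv]
    obtain ⟨R, hR⟩ : ∃ R, R = 1 / v - 1 + (δ + e ^ 2) / 2 := ⟨_, rfl⟩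
    have hRv : R = (v - 1) ^ 2 * (1 / 2 + 1 / v) := by
      have : δ + e ^ 2 = v ^ 2 - 1 := by linarith
      rw [hR, this]
      field_simp
      ring
    have hx : (δ + e ^ 2) ^ 2 ≤ (|δ| + e) ^ 2 := by
      refine sq_le_sq' ?_ ?_ <;> cases abs_cases δ <;> nlinarith
    have hinv : 1 / v ≤ 1.5 := by rw [div_le_iff₀ hv0]; linarith
    have hinv0 : 0 < 1 / v := by positivity
    have hR0 : 0 ≤ R := by rw [hRv]; positivity
    have hRle : R ≤ c * (|δ| + e) ^ 2 := by
      have h1 : R ≤ (v - 1) ^ 2 * 2 := by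
        rw [hRv]; exact mul_le_mul_of_nonneg_left (by linarith) (sq_nonneg _)
      have h2 : (v - 1) ^ 2 ≤ (δ + e ^ 2) ^ 2 := by
        have : δ + e ^ 2 = (v - 1) * (v + 1) := by linarith
        rw [this, mul_pow]
        exact le_mul_of_one_le_right (sq_nonneg _) (by nlinarith)
      nlinarith [sq_nonneg (|δ| + e)]
    have hAb : -(|A| + 1) * R ≤ (A + b) * R := by
      refine mul_le_mul_of_nonneg_right ?_ hR0
      linarith [neg_abs_le A, neg_abs_le b]
    have hmul : (|A| + 1) * R ≤ (|A| + 1) * (c * (|δ| + e) ^ 2) :=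
      mul_le_mul_of_nonneg_left hRle (by linarith)
    have hbe2 : b * e ^ 2 ≤ |b| * e := by
      have h1 : b * e ^ 2 ≤ |b| * e ^ 2 :=
        mul_le_mul_of_nonneg_right (le_abs_self b) (sq_nonneg e)
      have h2 : |b| * e ^ 2 ≤ |b| * e :=
        mul_le_mul_of_nonneg_left (by nlinarith) (abs_nonneg b)
      linarith
    have hexp : (A + b) / v = (A + b) * (1 - (δ + e ^ 2) / 2) + (A + b) * R := by
      rw [hR]; ring
    rw [hexp]
    linarith
  · refine le_trans ?_ hT
    have hδ0 : δ ≤ 0 := by nlinarith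
    rw [abs_of_nonpos hδ0] at hδ ⊢
    obtain ⟨d, rfl⟩ : ∃ d, δ = -d := ⟨-δ, by ring⟩
    rw [neg_neg] at hδ ⊢
    have he29 : 0.29 ≤ e := by nlinarith
    have hd2 : 1.41 * e ≤ d := by nlinarith [sq_nonneg (e - 0.705)]
    have hy : 0.874 ≤ d + e := by nlinarith
    obtain ⟨y, hy_eq⟩ : ∃ y, y = d + e := ⟨_, rfl⟩
    rw [← hy_eq] at hy ⊢
    have hysq : 0.763 ≤ y ^ 2 := by nlinarith
    have hey : e ≤ 0.42 * y := by linarith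
    have hA1 : A * (1 + (d - e ^ 2) / 2) ≤ |A| * 1.5 := by
      have h1 : A * (1 + (d - e ^ 2) / 2) ≤ |A| * (1 + (d - e ^ 2) / 2) :=
        mul_le_mul_of_nonneg_right (le_abs_self A) (by linarith)
      have h2 : |A| * (1 + (d - e ^ 2) / 2) ≤ |A| * 1.5 :=
        mul_le_mul_of_nonneg_left (by nlinarith [sq_nonneg (e - 1)]) hA0
      linarith
    have hb : b * (1 + d / 2) ≤ e * (1 + d / 2) :=
      mul_le_mul_of_nonneg_right ((le_abs_self b).trans hbe) (by nlinarith)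
    have hbe0 : 0 ≤ |b| * e := by positivity
    have hed : e * d ≤ y ^ 2 / 4 := by rw [hy_eq]; nlinarith [sq_nonneg (d - e)]
    have hey2 : e ≤ 0.49 * y ^ 2 := by nlinarith
    have hcy : 2.12 * ((|A| + 1) * y ^ 2) ≤ c * ((|A| + 1) * y ^ 2) :=
      mul_le_mul_of_nonneg_right hc.le (by positivity)
    have hAy : |A| * 1.5 ≤ 2.12 * (|A| * y ^ 2) := by nlinarith
    linarith

/-! ### Comparison of the similarities before and after the update -/

theorem sum_csim_le {ι : Type*} (S : Finset ι) {F : ι → ℝ → ℝ} {f₁ g₀ s s₀ : ℝ → ℝ} {θ : ι → ℝ}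
    {l : ℝ} (hF : ∀ j ∈ S, ContinuousOn (F j) (Set.Icc 0 1))
    (hf₁ : ContinuousOn f₁ (Set.Icc 0 1)) (hθ : ∀ j ∈ S, 0 ≤ θ j)
    (hg₀ : g₀ = fun t => ∑ j ∈ S, θ j * (F j t / cnorm (F j)))
    (hs : s = fun t => ∑ j ∈ S, F j t / cnorm (F j))
    (hs₀ : s₀ = fun t => ∑ j ∈ S, (F j t - cinner (F j) f₁ * f₁ t) / cnorm (F j))
    (hnorm : cnorm f₁ = 1) (hnonneg : ∀ j ∈ S, 0 ≤ cinner f₁ (F j))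
    (hpos : 0 < cinner g₀ s₀) (hl0 : 0 < l)
    (hl : ((cnorm (fun t => g₀ t - cinner g₀ f₁ * f₁ t)) ^ 2 * (cinner s f₁) ^ 2 -
      (cinner g₀ s₀) ^ 2) / (2 * cinner s f₁ * cinner g₀ s₀) - cinner g₀ f₁ ≤ l) :
    ∑ j ∈ S, csim f₁ (F j) ≤
      ∑ j ∈ S, csim (fun t => (l / (l + 1)) * f₁ t + (1 / (l + 1)) * g₀ t) (F j) := by
  have hψ := NonnegContDeriv.id
  simp only [csim, cinner_eq_winner, cnorm_eq_wnorm] at *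
  set ψ : ℝ → ℝ := fun t => t
  have hg₀' : g₀ = fun t => ∑ j ∈ S, (θ j / wnorm ψ (F j)) * F j t := by
    rw [hg₀]; ext t; exact Finset.sum_congr rfl fun j _ => by ring
  have hs' : s = fun t => ∑ j ∈ S, (1 / wnorm ψ (F j)) * F j t := by
    rw [hs]; ext t; exact Finset.sum_congr rfl fun j _ => by ring
  have hg₀c : ContinuousOn g₀ (Set.Icc 0 1) := by
    rw [hg₀']; exact continuousOn_finsetSum S fun j hj => (hF j hj).const_mul _
  have hsc : ContinuousOn s (Set.Icc 0 1) := by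
    rw [hs']; exact continuousOn_finsetSum S fun j hj => (hF j hj).const_mul _
  have hsum : ∀ φ : ℝ → ℝ, ContinuousOn φ (Set.Icc 0 1) →
      ∑ j ∈ S, winner ψ φ (F j) / (wnorm ψ φ * wnorm ψ (F j)) =
        winner ψ φ s / wnorm ψ φ := fun φ hφ => by
    rw [winner_comm ψ φ s, hs', winner_sum_left S hψ hF hφ, Finset.sum_div]
    refine Finset.sum_congr rfl fun j _ => ?_
    rw [winner_comm ψ φ]
    ring
  have hN : ∀ j, 0 ≤ wnorm ψ (F j) := fun j => wnorm_nonneg ψ _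
  have ha : 0 ≤ winner ψ s f₁ := by
    rw [hs', winner_sum_left S hψ hF hf₁]
    refine Finset.sum_nonneg fun j hj => mul_nonneg (div_nonneg zero_le_one (hN j)) ?_
    rw [winner_comm]; exact hnonneg j hj
  have hp : 0 ≤ winner ψ g₀ f₁ := by
    rw [hg₀', winner_sum_left S hψ hF hf₁]
    refine Finset.sum_nonneg fun j hj => mul_nonneg (div_nonneg (hθ j hj) (hN j)) ?_
    rw [winner_comm]; exact hnonneg j hj
  have hs₀' : s₀ = fun t => 1 * s t + (-winner ψ s f₁) * f₁ t := by
    rw [hs₀]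
    ext t
    rw [hs', winner_sum_left S hψ hF hf₁, ← Finset.sum_neg_distrib, Finset.sum_mul,
      Finset.mul_sum, ← Finset.sum_add_distrib]
    exact Finset.sum_congr rfl fun j _ => by ring
  have hq : winner ψ g₀ s₀ = winner ψ g₀ s - winner ψ s f₁ * winner ψ g₀ f₁ := by
    rw [hs₀', winner_lincomb_right hψ hsc hf₁ hg₀c]
    ring
  have hf₁f₁ : winner ψ f₁ f₁ = 1 := by rw [← wnorm_sq hψ, hnorm, one_pow]
  have hH : wnorm ψ (fun t => g₀ t - winner ψ g₀ f₁ * f₁ t) ^ 2 =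
      winner ψ g₀ g₀ - winner ψ g₀ f₁ ^ 2 := by
    have hfun : (fun t => g₀ t - winner ψ g₀ f₁ * f₁ t) =
        fun t => 1 * g₀ t + (-winner ψ g₀ f₁) * f₁ t := by ext t; ring
    rw [wnorm_sq hψ, hfun, winner_lincomb_self hψ hg₀c hf₁, hf₁f₁]
    ring
  have hH0 := sq_nonneg (wnorm ψ (fun t => g₀ t - winner ψ g₀ f₁ * f₁ t))
  rw [hsum f₁ hf₁, hsum _ (by fun_prop), hnorm, div_one,
    winner_lincomb_left hψ hf₁ hg₀c hsc, winner_comm ψ f₁ s]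
  have key := mul_sqrt_le_of_le ha hpos (by linarith) hl
  have hstar : wnorm ψ (fun t => (l / (l + 1)) * f₁ t + (1 / (l + 1)) * g₀ t) =
      1 / (l + 1) * √((l + winner ψ g₀ f₁) ^ 2 +
        wnorm ψ (fun t => g₀ t - winner ψ g₀ f₁ * f₁ t) ^ 2) := by
    rw [wnorm, winner_lincomb_self hψ hf₁ hg₀c, hf₁f₁, hH, winner_comm ψ f₁ g₀,
      ← Real.sqrt_sq (show 0 ≤ 1 / (l + 1) by positivity), ← Real.sqrt_mul (sq_nonneg _),
      Real.sqrt_sq (show 0 ≤ 1 / (l + 1) by positivity)]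
    congr 1
    ring
  have hsqrt : 0 < √((l + winner ψ g₀ f₁) ^ 2 +
      wnorm ψ (fun t => g₀ t - winner ψ g₀ f₁ * f₁ t) ^ 2) := by positivity
  rw [hstar, le_div_iff₀ (by positivity)]
  have hl1 : 0 < 1 / (l + 1) := by positivity
  calc winner ψ s f₁ * (1 / (l + 1) * _) = 1 / (l + 1) * (winner ψ s f₁ * _) := by ring
    _ ≤ 1 / (l + 1) * ((l + winner ψ g₀ f₁) * winner ψ s f₁ + winner ψ g₀ s₀) :=
        mul_le_mul_of_nonneg_left key hl1.le
    _ = _ := by rw [hq]; ring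

theorem winner_lincomb_div_wnorm_ge {ψ f₁ g₀ F : ℝ → ℝ} {l A B D E : ℝ}
    (hψ : NonnegContDeriv ψ) (hf₁ : ContinuousOn f₁ (Set.Icc 0 1))
    (hg₀ : ContinuousOn g₀ (Set.Icc 0 1)) (hF : ContinuousOn F (Set.Icc 0 1))
    (hFn : wnorm ψ F = 1) (hf₁n : 0 < wnorm ψ f₁)
    (hA : A = winner ψ f₁ F / wnorm ψ f₁) (hB : B = winner ψ g₀ F / wnorm ψ f₁)
    (hD : D = 2 * winner ψ f₁ g₀ / wnorm ψ f₁ ^ 2) (hE : E = wnorm ψ g₀ / wnorm ψ f₁)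
    (hl0 : 0 < l) (hEl : E ≤ l) (hBl : |B| ≤ l) :
    A + (1 / l) * (B - 1 / 2 * A * D) - (1 / l) ^ 2 *
        (1 / 2 * (A * E ^ 2 + B * D + |B| * E) + 3 / √2 * (|A| + 1) * (|D| + E) ^ 2) ≤
      winner ψ (fun t => (l / (l + 1)) * f₁ t + (1 / (l + 1)) * g₀ t) F /
        wnorm ψ (fun t => (l / (l + 1)) * f₁ t + (1 / (l + 1)) * g₀ t) := by
  have hT : -1 ≤ winner ψ (fun t => (l / (l + 1)) * f₁ t + (1 / (l + 1)) * g₀ t) F /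
      wnorm ψ (fun t => (l / (l + 1)) * f₁ t + (1 / (l + 1)) * g₀ t) := by
    refine (abs_le.mp ?_).1
    rw [abs_div, abs_of_nonneg (wnorm_nonneg ψ _)]
    refine div_le_one_of_le₀ ?_ (wnorm_nonneg ψ _)
    simpa only [hFn, mul_one] using abs_winner_le hψ
      (f := fun t => (l / (l + 1)) * f₁ t + (1 / (l + 1)) * g₀ t) (by fun_prop) hF
  have hf₁F : winner ψ f₁ F = wnorm ψ f₁ * A := by rw [hA]; field_simp
  have hg₀F : winner ψ g₀ F = wnorm ψ f₁ * B := by rw [hB]; field_simp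
  have hf₁g₀ : winner ψ f₁ g₀ = wnorm ψ f₁ ^ 2 * D / 2 := by rw [hD]; field_simp
  have hg₀n : wnorm ψ g₀ = wnorm ψ f₁ * E := by rw [hE]; field_simp
  have hE0 : 0 ≤ E := by rw [hE]; exact div_nonneg (wnorm_nonneg ψ _) hf₁n.le
  have hBE : |B| ≤ E := by
    rw [hB, hE, abs_div, abs_of_pos hf₁n]
    gcongr
    simpa only [hFn, mul_one] using abs_winner_le hψ hg₀ hF
  have hDE : |D| ≤ 2 * E := by
    have h := abs_winner_le hψ hf₁ hg₀
    rw [hg₀n] at h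
    rw [hD, abs_div, abs_mul, abs_of_pos (show (0:ℝ) < 2 by norm_num),
      abs_of_pos (pow_pos hf₁n 2), div_le_iff₀ (pow_pos hf₁n 2)]
    linarith
  have heq : winner ψ (fun t => (l / (l + 1)) * f₁ t + (1 / (l + 1)) * g₀ t) F /
      wnorm ψ (fun t => (l / (l + 1)) * f₁ t + (1 / (l + 1)) * g₀ t) =
      (A + 1 / l * B) / √(1 + 1 / l * D + (1 / l * E) ^ 2) := by
    have hc : 0 < l / (l + 1) * wnorm ψ f₁ := by positivity
    have h1 : winner ψ (fun t => (l / (l + 1)) * f₁ t + (1 / (l + 1)) * g₀ t) F =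
        l / (l + 1) * wnorm ψ f₁ * (A + 1 / l * B) := by
      rw [winner_lincomb_left hψ hf₁ hg₀ hF, hf₁F, hg₀F]
      field_simp
    have h2 : wnorm ψ (fun t => (l / (l + 1)) * f₁ t + (1 / (l + 1)) * g₀ t) =
        l / (l + 1) * wnorm ψ f₁ * √(1 + 1 / l * D + (1 / l * E) ^ 2) := by
      rw [wnorm, winner_lincomb_self hψ hf₁ hg₀, ← wnorm_sq hψ f₁, ← wnorm_sq hψ g₀, hg₀n, hf₁g₀,
        ← Real.sqrt_sq hc.le, ← Real.sqrt_mul (sq_nonneg _)]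
      congr 1
      field_simp
    rw [h1, h2, mul_div_mul_left _ _ hc.ne']
  rw [heq] at hT ⊢
  have hl1 : 0 < 1 / l := by positivity
  have habs : ∀ x : ℝ, |1 / l * x| = 1 / l * |x| := fun x => by rw [abs_mul, abs_of_pos hl1]
  have hle1 : ∀ x : ℝ, x ≤ l → 1 / l * x ≤ 1 := fun x hx => by
    rw [one_div_mul_eq_div]; exact div_le_one_of_le₀ hx hl0.le
  have key := lincomb_div_sqrt_ge (by positivity : 0 ≤ 1 / l * E) (hle1 E hEl)
    (by rw [habs]; exact hle1 _ hBl)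
    (by rw [habs]; exact mul_le_mul_of_nonneg_left hBE hl1.le)
    (by rw [habs]; linarith [mul_le_mul_of_nonneg_left hDE hl1.le]) hT
  rw [habs, habs] at key
  refine le_trans (le_of_eq ?_) key
  ring

/-- Theorem 1: under (C1)–(C6), positivity of the relevant semi-norms,
attainment of the supremum `ρ(f₁, fⱼ)` at `ψⱼ`, and boundedness above of
`{ρ(f₁*, fⱼ | ψ) : ψ ∈ 𝓜}`, one has `Σⱼ ρ(f₁*, fⱼ) ≥ Σⱼ ρ(f₁, fⱼ)`. -/
theorem stmt_2
    (k : ℕ) (hk : 2 ≤ k) (f : ℕ → ℝ → ℝ)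
    (hf : ∀ j ∈ Finset.Icc 1 k, ContinuousOn (f j) (Set.Icc (0:ℝ) 1))
    (w : ℕ → Warp)
    (θ : ℕ → ℝ) (hθ : ∀ j ∈ Finset.Icc 2 k, θ j ∈ Set.Icc (0:ℝ) 1)
    (hθsum : ∑ j ∈ Finset.Icc 2 k, θ j = 1)
    (lam : ℝ) (hlam : 0 < lam)
    (g₀ : ℝ → ℝ)
    (hg₀ : g₀ = fun t => ∑ j ∈ Finset.Icc 2 k,
      θ j * (f j ((w j).toFun t) / cnorm (f j ∘ (w j).toFun)))
    (fstar : ℝ → ℝ)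
    (hfstar : fstar = fun t => (lam / (lam + 1)) * f 1 t + (1 / (lam + 1)) * g₀ t)
    (s : ℝ → ℝ)
    (hs : s = fun t => ∑ j ∈ Finset.Icc 2 k,
      f j ((w j).toFun t) / cnorm (f j ∘ (w j).toFun))
    (s₀ : ℝ → ℝ)
    (hs₀ : s₀ = fun t => ∑ j ∈ Finset.Icc 2 k,
      (f j ((w j).toFun t) - cinner (f j ∘ (w j).toFun) (f 1) * f 1 t) /
        cnorm (f j ∘ (w j).toFun))
    (A B D E α β : ℕ → ℝ)
    (hA : ∀ j ∈ Finset.Icc 2 k, A j =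
      winner (w j).toFun (f 1) (f j ∘ (w j).toFun) / wnorm (w j).toFun (f 1))
    (hB : ∀ j ∈ Finset.Icc 2 k, B j =
      winner (w j).toFun g₀ (f j ∘ (w j).toFun) / wnorm (w j).toFun (f 1))
    (hD : ∀ j ∈ Finset.Icc 2 k, D j =
      2 * winner (w j).toFun (f 1) g₀ / (wnorm (w j).toFun (f 1)) ^ 2)
    (hE : ∀ j ∈ Finset.Icc 2 k, E j =
      wnorm (w j).toFun g₀ / wnorm (w j).toFun (f 1))
    (hα : ∀ j ∈ Finset.Icc 2 k, α j = B j - (1 / 2) * A j * D j)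
    (hβ : ∀ j ∈ Finset.Icc 2 k, β j =
      (1 / 2) * (A j * E j ^ 2 + B j * D j + |B j| * E j) +
        (3 / Real.sqrt 2) * (|A j| + 1) * (|D j| + E j) ^ 2)
    (LC5 : ℝ)
    (hLC5 : LC5 = ((cnorm (fun t => g₀ t - cinner g₀ (f 1) * f 1 t)) ^ 2 *
        (cinner s (f 1)) ^ 2 - (cinner g₀ s₀) ^ 2) /
        (2 * cinner s (f 1) * cinner g₀ s₀) - cinner g₀ (f 1))
    (LC6 : ℝ)
    (hLC6 : LC6 = max ((∑ j ∈ Finset.Icc 2 k, β j) / (∑ j ∈ Finset.Icc 2 k, α j))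
      ((Finset.Icc 2 k).sup' (Finset.nonempty_Icc.mpr hk) fun j => max (E j) |B j|))
    (hC1 : ∀ j ∈ Finset.Icc 1 k, cnorm (f j) = 1)
    (hC2 : ∀ j ∈ Finset.Icc 2 k, 0 ≤ cinner (f 1) (f j ∘ (w j).toFun))
    (hC3 : 0 < cinner g₀ s₀)
    (hC4 : 0 < ∑ l ∈ Finset.Icc 2 k, winner (w l).toFun g₀
      (fun t => (1 / wnorm (w l).toFun (f 1)) *
        (f l ((w l).toFun t) -
          winner (w l).toFun (f l ∘ (w l).toFun) (f 1) * f 1 t /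
            (wnorm (w l).toFun (f 1)) ^ 2)))
    (hC5 : lam ≥ LC5)
    (hC6 : lam ≥ LC6)
    (hpos : ∀ j ∈ Finset.Icc 2 k, 0 < cnorm (f j ∘ (w j).toFun))
    (hpos1 : ∀ j ∈ Finset.Icc 2 k, 0 < wnorm (w j).toFun (f 1))
    (l₀ : ℝ) (hl₀ : 0 ≤ l₀)
    (hattain : ∀ j ∈ Finset.Icc 2 k, rhoSim l₀ (f 1) (f j) = rhoW l₀ (f 1) (f j) (w j))
    (hbdd : ∀ j ∈ Finset.Icc 2 k,
      BddAbove (Set.range fun ψ : Warp => rhoW l₀ fstar (f j) ψ)) :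
    ∑ j ∈ Finset.Icc 2 k, rhoSim l₀ fstar (f j) ≥
      ∑ j ∈ Finset.Icc 2 k, rhoSim l₀ (f 1) (f j) := by
  have hsub : ∀ j ∈ Finset.Icc 2 k, j ∈ Finset.Icc 1 k := fun j hj => by
    rw [Finset.mem_Icc] at hj ⊢; omega
  have hf1 : ContinuousOn (f 1) (Set.Icc 0 1) := hf 1 (by rw [Finset.mem_Icc]; omega)
  have hn1 : cnorm (f 1) = 1 := hC1 1 (by rw [Finset.mem_Icc]; omega)
  have hF : ∀ j ∈ Finset.Icc 2 k, ContinuousOn (f j ∘ (w j).toFun) (Set.Icc 0 1) :=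
    fun j hj => (hf j (hsub j hj)).comp (w j).continuousOn (w j).maps_to
  have hg₀c : ContinuousOn g₀ (Set.Icc 0 1) := by
    rw [hg₀]
    exact continuousOn_finsetSum _ fun j hj => ((hF j hj).div_const _).const_mul _
  have hfsc : ContinuousOn fstar (Set.Icc 0 1) := by rw [hfstar]; fun_prop
  have hcsim : ∑ j ∈ Finset.Icc 2 k, csim (f 1) (f j ∘ (w j).toFun) ≤
      ∑ j ∈ Finset.Icc 2 k, csim fstar (f j ∘ (w j).toFun) := by
    rw [hfstar]
    exact sum_csim_le _ hF hf1 (fun j hj => (hθ j hj).1) hg₀ hs hs₀ hn1 hC2 hC3 hlam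
      (hLC5 ▸ hC5)
  have hmax := hLC6 ▸ hC6
  have hαsum : 0 < ∑ j ∈ Finset.Icc 2 k, α j := by
    refine hC4.trans_eq (Finset.sum_congr rfl fun j hj => ?_)
    have hfun : (fun t => (1 / wnorm (w j).toFun (f 1)) * (f j ((w j).toFun t) -
        winner (w j).toFun (f j ∘ (w j).toFun) (f 1) * f 1 t / wnorm (w j).toFun (f 1) ^ 2)) =
        fun t => (1 / wnorm (w j).toFun (f 1)) * (f j ∘ (w j).toFun) t +
          (-(winner (w j).toFun (f j ∘ (w j).toFun) (f 1) / wnorm (w j).toFun (f 1) ^ 3)) *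
            f 1 t := by
      ext t
      simp only [Function.comp_apply]
      ring
    rw [hfun, winner_lincomb_right (w j).nonnegContDeriv (hF j hj) hf1 hg₀c, hα j hj, hA j hj,
      hB j hj, hD j hj, winner_comm _ g₀ (f 1), winner_comm _ (f j ∘ _) (f 1)]
    ring
  have hβsum : ∑ j ∈ Finset.Icc 2 k, β j ≤ lam * ∑ j ∈ Finset.Icc 2 k, α j :=
    (div_le_iff₀ hαsum).mp ((le_max_left _ _).trans hmax)
  have hterm : ∀ j ∈ Finset.Icc 2 k, A j + (1 / lam) * α j - (1 / lam) ^ 2 * β j ≤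
      csim (f j) (fstar ∘ (w j).invFun) := fun j hj => by
    have hEB : max (E j) |B j| ≤ lam :=
      (Finset.le_sup' (fun j => max (E j) |B j|) hj).trans ((le_max_right _ _).trans hmax)
    rw [(w j).csim_comp_inv hfsc (hf j (hsub j hj)) (hC1 j (hsub j hj)), hα j hj, hβ j hj, hfstar]
    exact winner_lincomb_div_wnorm_ge (w j).nonnegContDeriv hf1 hg₀c (hF j hj)
      (((w j).wnorm_comp (hf j (hsub j hj))).trans (hC1 j (hsub j hj))) (hpos1 j hj)
      (hA j hj) (hB j hj) (hD j hj) (hE j hj) hlam ((le_max_left _ _).trans hEB)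
      ((le_max_right _ _).trans hEB)
  have hcsim_inv : ∑ j ∈ Finset.Icc 2 k, csim (f j) (f 1 ∘ (w j).invFun) ≤
      ∑ j ∈ Finset.Icc 2 k, csim (f j) (fstar ∘ (w j).invFun) := by
    refine le_trans ?_ (Finset.sum_le_sum hterm)
    have hAsum : ∑ j ∈ Finset.Icc 2 k, csim (f j) (f 1 ∘ (w j).invFun) =
        ∑ j ∈ Finset.Icc 2 k, A j := Finset.sum_congr rfl fun j hj => by
      rw [(w j).csim_comp_inv hf1 (hf j (hsub j hj)) (hC1 j (hsub j hj)), hA j hj]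
    rw [hAsum, Finset.sum_sub_distrib, Finset.sum_add_distrib, ← Finset.mul_sum, ← Finset.mul_sum]
    have h : (1 / lam) ^ 2 * ∑ j ∈ Finset.Icc 2 k, β j ≤
        1 / lam * ∑ j ∈ Finset.Icc 2 k, α j :=
      (mul_le_mul_of_nonneg_left hβsum (by positivity)).trans_eq (by field_simp)
    linarith
  calc ∑ j ∈ Finset.Icc 2 k, rhoSim l₀ (f 1) (f j)
      = ∑ j ∈ Finset.Icc 2 k, rhoW l₀ (f 1) (f j) (w j) := Finset.sum_congr rfl hattain
    _ ≤ ∑ j ∈ Finset.Icc 2 k, rhoW l₀ fstar (f j) (w j) := by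
        simp only [rhoW, rhoStar]
        rw [← Finset.sum_div, ← Finset.sum_div]
        simp only [Finset.sum_add_distrib, Finset.sum_sub_distrib]
        linarith
    _ ≤ ∑ j ∈ Finset.Icc 2 k, rhoSim l₀ fstar (f j) :=
        Finset.sum_le_sum fun j hj => le_ciSup (hbdd j hj) (w j)

end
end

section
/- Assume conditions (C1), (C2), (C4) and (C6) hold, λ > 0, and ‖f_j∘ψ_j‖ > 0 and ‖f₁‖_j > 0 for 2 ≤ j ≤ k. Then Σ_{j=2}^k r(f₁∘ψ_j⁻¹, f_j) ≤ Σ_{j=2}^k r((λf₁ + g₀)∘ψ_j⁻¹, f_j). -/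
noncomputable section

/-- Second-order upper bound for `1 / √(1 + x)` on `x ≥ -1/2`, written with `s = √(1 + x)`. -/
lemma inv_le_quadratic {s : ℝ} (hs : 0 < s) (h : 1 / 2 ≤ s ^ 2) :
    1 / s ≤ 1 - (s ^ 2 - 1) / 2 + 3 / √2 * (s ^ 2 - 1) ^ 2 := by
  have h2 : (0 : ℝ) < √2 := by positivity
  have hsq : √2 ^ 2 = 2 := Real.sq_sqrt (by norm_num)
  have h1 : 1 ≤ s * √2 := by
    nlinarith [mul_pos hs h2, mul_pow s (√2) 2]
  have hC : 3 / 2 ≤ 3 / √2 * s := by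
    have : 3 / √2 * s = 3 / 2 * (s * √2) := by
      field_simp
      rw [hsq]
    rw [this]
    linarith
  rw [div_le_iff₀ hs]
  have key : (s + 2) / 2 ≤ 3 / √2 * s * (s + 1) ^ 2 := by
    have := mul_le_mul_of_nonneg_right hC (sq_nonneg (s + 1))
    nlinarith
  nlinarith [mul_le_mul_of_nonneg_left key (sq_nonneg (s - 1))]

/-- Tangent-line lower bound for `1 / √(1 + x)`, written with `s = √(1 + x)`. -/
lemma linear_le_inv {s : ℝ} (hs : 0 < s) : 1 - (s ^ 2 - 1) / 2 ≤ 1 / s := by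
  rw [le_div_iff₀ hs]
  nlinarith [mul_nonneg (sq_nonneg (s - 1)) (by linarith : (0 : ℝ) ≤ s + 2)]

lemma quadratic_lower_bound {a b d e : ℝ} (he : 0 ≤ e) (he1 : e ≤ 1) (hd : |d| ≤ 2 * e)
    (hb : |b| ≤ 1) (hcs : (a + b) ^ 2 ≤ 1 + d + e ^ 2) :
    a + b - a * d / 2 - (1 / 2 * (a * e ^ 2 + b * d + |b| * e) +
      3 / √2 * (|a| + 1) * (|d| + e) ^ 2) ≤ (a + b) / √(1 + d + e ^ 2) := by
  set C : ℝ := 3 / √2 with hCdef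
  have hC : 2 ≤ C := by
    rw [hCdef, le_div_iff₀ (by positivity)]
    nlinarith [Real.sqrt_nonneg 2, Real.sq_sqrt (show (0 : ℝ) ≤ 2 by norm_num)]
  have hx0 : 0 ≤ 1 + d + e ^ 2 := (sq_nonneg _).trans hcs
  set s := √(1 + d + e ^ 2) with hs
  have hs2 : s ^ 2 = 1 + d + e ^ 2 := Real.sq_sqrt hx0
  have hs0 : 0 ≤ s := Real.sqrt_nonneg _
  have habs : |a + b| ≤ s := abs_le_of_sq_le_sq (by rw [hs2]; exact hcs) hs0
  have hbe : b * e ^ 2 ≤ |b| * e := by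
    have h1 : b * e ^ 2 ≤ |b| * e ^ 2 := by gcongr; exact le_abs_self b
    have h2 : |b| * e ^ 2 ≤ |b| * e := by gcongr; nlinarith
    exact h1.trans h2
  have hrem : 0 ≤ C * (|a| + 1) * (|d| + e) ^ 2 := by positivity
  suffices h : (a + b) * (1 - (s ^ 2 - 1) / 2) - C * (|a| + 1) * (|d| + e) ^ 2 ≤ (a + b) / s by
    rw [hs2] at h
    linarith
  rcases hs0.eq_or_lt with h0 | hpos
  · have : a + b = 0 := abs_nonpos_iff.mp (h0 ▸ habs)
    rw [this]
    simpa using hrem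
  rcases le_or_gt 0 (a + b) with hab | hab
  · have := mul_le_mul_of_nonneg_left (linear_le_inv hpos) hab
    rw [mul_one_div] at this
    linarith
  have hsum : -(a + b) ≤ |a| + 1 := by linarith [neg_abs_le a, neg_abs_le b]
  rcases le_or_gt (1 / 2) (s ^ 2) with hhalf | hhalf
  · have hq := mul_le_mul_of_nonneg_left (inv_le_quadratic hpos hhalf)
      (by linarith : 0 ≤ -(a + b))
    rw [mul_one_div, neg_div, ← hCdef] at hq
    have hxle : (s ^ 2 - 1) ^ 2 ≤ (|d| + e) ^ 2 := by
      apply sq_le_sq'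
      · nlinarith [neg_abs_le d, sq_nonneg e]
      · nlinarith [le_abs_self d, mul_nonneg he (sub_nonneg.mpr he1)]
    have : -(a + b) * (C * (s ^ 2 - 1) ^ 2) ≤ (|a| + 1) * (C * (|d| + e) ^ 2) := by
      gcongr
    linarith
  · have h1 : -1 ≤ (a + b) / s := by
      rw [le_div_iff₀ hpos]
      linarith [(abs_le.mp habs).1]
    have hd' : 1 / 2 ≤ |d| := by nlinarith [neg_abs_le d, sq_nonneg e]
    have hsq : 1 / 2 ≤ (|d| + e) ^ 2 := by nlinarith
    have h2 : 1 ≤ C * (|a| + 1) * (|d| + e) ^ 2 := by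
      have : 2 * 1 * (1 / 2) ≤ C * (|a| + 1) * (|d| + e) ^ 2 := by
        gcongr
        linarith [abs_nonneg a]
      linarith
    have h3 : (a + b) * (1 - (s ^ 2 - 1) / 2) ≤ 0 :=
      mul_nonpos_of_nonpos_of_nonneg hab.le (by linarith)
    linarith

lemma ContinuousOn.intervalIntegrable_zero_one {u : ℝ → ℝ}
    (hu : ContinuousOn u (Set.Icc (0 : ℝ) 1)) :
    IntervalIntegrable u MeasureTheory.volume 0 1 :=
  hu.intervalIntegrable_of_Icc zero_le_one

lemma Emean_congr {u v : ℝ → ℝ} (h : Set.EqOn u v (Set.Icc (0 : ℝ) 1)) : Emean u = Emean v :=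
  intervalIntegral.integral_congr (by rwa [Set.uIcc_of_le zero_le_one])

lemma cinner_congr {u u' v v' : ℝ → ℝ} (hu : Set.EqOn u u' (Set.Icc (0 : ℝ) 1))
    (hv : Set.EqOn v v' (Set.Icc (0 : ℝ) 1)) : cinner u v = cinner u' v' := by
  unfold cinner
  rw [Emean_congr hu, Emean_congr hv]
  refine intervalIntegral.integral_congr fun x hx => ?_
  rw [Set.uIcc_of_le zero_le_one] at hx
  simp only [hu hx, hv hx]

lemma winner_comm_s5 (ψ u v : ℝ → ℝ) : winner ψ u v = winner ψ v u := by
  unfold winner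
  simp only [mul_comm]

lemma cinner_comm (u v : ℝ → ℝ) : cinner u v = cinner v u := by
  unfold cinner
  simp only [mul_comm]

lemma cinner_self_nonneg (u : ℝ → ℝ) : 0 ≤ cinner u u :=
  intervalIntegral.integral_nonneg zero_le_one fun _ _ => mul_self_nonneg _

lemma cnorm_sq (u : ℝ → ℝ) : cnorm u ^ 2 = cinner u u := Real.sq_sqrt (cinner_self_nonneg u)

lemma cinner_linear_left {u v z : ℝ → ℝ} (hu : ContinuousOn u (Set.Icc (0 : ℝ) 1))
    (hv : ContinuousOn v (Set.Icc (0 : ℝ) 1)) (hz : ContinuousOn z (Set.Icc (0 : ℝ) 1))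
    (a b : ℝ) :
    cinner (fun t => a * u t + b * v t) z = a * cinner u z + b * cinner v z := by
  have hE : Emean (fun t => a * u t + b * v t) = a * Emean u + b * Emean v := by
    unfold Emean
    rw [intervalIntegral.integral_add (hu.intervalIntegrable_zero_one.const_mul a)
      (hv.intervalIntegrable_zero_one.const_mul b)]
    simp
  unfold cinner
  rw [hE, ← intervalIntegral.integral_const_mul, ← intervalIntegral.integral_const_mul,
    ← intervalIntegral.integral_add]
  · refine intervalIntegral.integral_congr fun x _ => ?_
    ring
  · exact ContinuousOn.intervalIntegrable_zero_one (by fun_prop)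
  · exact ContinuousOn.intervalIntegrable_zero_one (by fun_prop)

lemma cinner_linear_self {u v : ℝ → ℝ} (hu : ContinuousOn u (Set.Icc (0 : ℝ) 1))
    (hv : ContinuousOn v (Set.Icc (0 : ℝ) 1)) (a b : ℝ) :
    cinner (fun t => a * u t + b * v t) (fun t => a * u t + b * v t) =
      a ^ 2 * cinner u u + 2 * a * b * cinner u v + b ^ 2 * cinner v v := by
  have hw : ContinuousOn (fun t => a * u t + b * v t) (Set.Icc (0 : ℝ) 1) := by fun_prop
  rw [cinner_linear_left hu hv hw, cinner_comm u, cinner_comm v,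
    cinner_linear_left hu hv hu, cinner_linear_left hu hv hv, cinner_comm v u]
  ring

lemma cinner_sq_le {u v : ℝ → ℝ} (hu : ContinuousOn u (Set.Icc (0 : ℝ) 1))
    (hv : ContinuousOn v (Set.Icc (0 : ℝ) 1)) :
    cinner u v ^ 2 ≤ cinner u u * cinner v v := by
  have h := discrim_le_zero (a := cinner v v) (b := 2 * cinner u v) (c := cinner u u) fun x => by
    have := cinner_self_nonneg (fun t => 1 * u t + x * v t)
    rw [cinner_linear_self hu hv] at this
    linarith
  unfold discrim at h
  linarith

lemma abs_cinner_le {u v : ℝ → ℝ} (hu : ContinuousOn u (Set.Icc (0 : ℝ) 1))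
    (hv : ContinuousOn v (Set.Icc (0 : ℝ) 1)) :
    |cinner u v| ≤ cnorm u * cnorm v :=
  abs_le_of_sq_le_sq (by rw [mul_pow, cnorm_sq, cnorm_sq]; exact cinner_sq_le hu hv)
    (mul_nonneg (Real.sqrt_nonneg _) (Real.sqrt_nonneg _))

/-- Second-order lower bound for the similarity of `lam * u + v` to a unit vector `z`. -/
lemma le_csim_linear {u v z : ℝ → ℝ} (hu : ContinuousOn u (Set.Icc (0 : ℝ) 1))
    (hv : ContinuousOn v (Set.Icc (0 : ℝ) 1)) (hz : ContinuousOn z (Set.Icc (0 : ℝ) 1))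
    (hz1 : cnorm z = 1) (hupos : 0 < cnorm u) {lam A B D E : ℝ} (hlam : 0 < lam)
    (hA : A = cinner u z / cnorm u) (hB : B = cinner v z / cnorm u)
    (hD : D = 2 * cinner u v / cnorm u ^ 2) (hE : E = cnorm v / cnorm u)
    (hlamE : E ≤ lam) (hlamB : |B| ≤ lam) :
    csim u z + (lam * (B - 1 / 2 * A * D) - (1 / 2 * (A * E ^ 2 + B * D + |B| * E) +
      3 / √2 * (|A| + 1) * (|D| + E) ^ 2)) / lam ^ 2 ≤
      csim (fun t => lam * u t + v t) z := by
  have hsum : (fun t => lam * u t + v t) = fun t => lam * u t + 1 * v t := by simp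
  have hn := cnorm_sq (fun t => lam * u t + v t)
  have hc := cinner_linear_left hu hv hz lam 1
  have hcs : cinner (fun t => lam * u t + v t) z ^ 2 ≤ _ :=
    cinner_sq_le (by fun_prop) hz
  have hnorm : cnorm (fun t => lam * u t + v t) =
      lam * cnorm u * √(1 + D / lam + (E / lam) ^ 2) := by
    rw [cnorm, hsum, cinner_linear_self hu hv]
    rw [← Real.sqrt_sq (mul_nonneg hlam.le hupos.le), ← Real.sqrt_mul (sq_nonneg _)]
    congr 1
    rw [hD, hE, ← cnorm_sq u, ← cnorm_sq v]
    field_simp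
  have hinner : cinner (fun t => lam * u t + v t) z = lam * cnorm u * (A + B / lam) := by
    rw [hsum, hc, hA, hB]
    field_simp
  have hx : 0 ≤ 1 + D / lam + (E / lam) ^ 2 := by
    have := cinner_self_nonneg (fun t => lam * u t + v t)
    rw [hsum, cinner_linear_self hu hv, ← cnorm_sq u, ← cnorm_sq v] at this
    have h2 : 1 + D / lam + (E / lam) ^ 2 = (lam ^ 2 * cnorm u ^ 2 + 2 * lam * 1 * cinner u v +
        1 ^ 2 * cnorm v ^ 2) / (lam * cnorm u) ^ 2 := by
      rw [hD, hE]
      field_simp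
    rw [h2]
    exact div_nonneg this (sq_nonneg _)
  have hE0 : 0 ≤ E := hE ▸ div_nonneg (Real.sqrt_nonneg _) hupos.le
  have hDE : |D| ≤ 2 * E := by
    rw [hD, hE, abs_div, abs_mul, abs_of_pos (pow_pos hupos 2), div_le_iff₀ (pow_pos hupos 2)]
    have := abs_cinner_le hu hv
    have h3 : 2 * (cnorm v / cnorm u) * cnorm u ^ 2 = 2 * (cnorm u * cnorm v) := by
      field_simp
    rw [h3, abs_two]
    linarith
  have hcs' : (A + B / lam) ^ 2 ≤ 1 + D / lam + (E / lam) ^ 2 := by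
    rw [hinner, ← cnorm_sq z, hz1, ← hn, hnorm, mul_pow, mul_pow _ (√_), Real.sq_sqrt hx,
      one_pow, mul_one] at hcs
    exact le_of_mul_le_mul_left hcs (by positivity)
  have key := quadratic_lower_bound (a := A) (b := B / lam) (d := D / lam) (e := E / lam)
    (by positivity) (by rw [div_le_one hlam]; exact hlamE)
    (by rw [abs_div, abs_of_pos hlam, ← mul_div_assoc]; gcongr)
    (by rw [abs_div, abs_of_pos hlam, div_le_one hlam]; exact hlamB) hcs'
  have hL : csim u z = A := by rw [csim, hz1, mul_one, hA]
  have hR : csim (fun t => lam * u t + v t) z =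
      (A + B / lam) / √(1 + D / lam + (E / lam) ^ 2) := by
    rw [csim, hz1, mul_one, hinner, hnorm]
    exact mul_div_mul_left _ _ (by positivity)
  rw [hL, hR]
  refine le_of_eq_of_le ?_ key
  rw [abs_div, abs_div, abs_of_pos hlam]
  field_simp
  ring

namespace Warp

variable (w : Warp)

lemma continuousOn_toFun : ContinuousOn w.toFun (Set.Icc (0 : ℝ) 1) :=
  fun t ht => (w.diff t ht).continuousAt.continuousWithinAt

lemma continuousOn_comp_toFun {u : ℝ → ℝ} (hu : ContinuousOn u (Set.Icc (0 : ℝ) 1)) :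
    ContinuousOn (u ∘ w.toFun) (Set.Icc (0 : ℝ) 1) :=
  hu.comp w.continuousOn_toFun w.maps_to

lemma continuousOn_comp_invFun {u : ℝ → ℝ} (hu : ContinuousOn u (Set.Icc (0 : ℝ) 1)) :
    ContinuousOn (u ∘ w.invFun) (Set.Icc (0 : ℝ) 1) :=
  hu.comp (fun t ht => (w.inv_diff t ht).continuousAt.continuousWithinAt) w.inv_maps_to

lemma integral_comp_mul_deriv_s5 {u : ℝ → ℝ} (hu : ContinuousOn u (Set.Icc (0 : ℝ) 1)) :
    ∫ t in (0 : ℝ)..1, u (w.toFun t) * deriv w.toFun t = ∫ x in (0 : ℝ)..1, u x := by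
  have hI : Set.uIcc (0 : ℝ) 1 = Set.Icc 0 1 := Set.uIcc_of_le zero_le_one
  have h := intervalIntegral.integral_comp_mul_deriv'' (a := 0) (b := 1) (f := w.toFun)
    (f' := deriv w.toFun) (g := u) (by rw [hI]; exact w.continuousOn_toFun)
    (fun x hx => (w.diff x (Set.Ioo_subset_Icc_self (by simpa using hx))).hasDerivAt.hasDerivWithinAt)
    (by rw [hI]; exact w.deriv_cont)
    (by rw [hI]; exact hu.mono (Set.image_subset_iff.mpr w.maps_to))
  rwa [w.map_zero, w.map_one] at h

lemma wE_eq_Emean {u : ℝ → ℝ} (hu : ContinuousOn u (Set.Icc (0 : ℝ) 1)) :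
    wE w.toFun u = Emean (u ∘ w.invFun) := by
  unfold wE Emean
  rw [← w.integral_comp_mul_deriv_s5 (w.continuousOn_comp_invFun hu)]
  refine intervalIntegral.integral_congr fun t ht => ?_
  rw [Set.uIcc_of_le zero_le_one] at ht
  simp only [Function.comp_apply, w.left_inv t ht]

lemma winner_eq_cinner {u v : ℝ → ℝ} (hu : ContinuousOn u (Set.Icc (0 : ℝ) 1))
    (hv : ContinuousOn v (Set.Icc (0 : ℝ) 1)) :
    winner w.toFun u v = cinner (u ∘ w.invFun) (v ∘ w.invFun) := by
  have hu' := w.continuousOn_comp_invFun hu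
  have hv' := w.continuousOn_comp_invFun hv
  unfold winner cinner
  rw [w.wE_eq_Emean hu, w.wE_eq_Emean hv,
    ← w.integral_comp_mul_deriv_s5 (u := fun x => ((u ∘ w.invFun) x - Emean (u ∘ w.invFun)) *
      ((v ∘ w.invFun) x - Emean (v ∘ w.invFun)))
      ((hu'.sub continuousOn_const).mul (hv'.sub continuousOn_const))]
  refine intervalIntegral.integral_congr fun t ht => ?_
  rw [Set.uIcc_of_le zero_le_one] at ht
  simp only [Function.comp_apply, w.left_inv t ht]

lemma winner_linear_right {u v z : ℝ → ℝ} (hz : ContinuousOn z (Set.Icc (0 : ℝ) 1))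
    (hu : ContinuousOn u (Set.Icc (0 : ℝ) 1)) (hv : ContinuousOn v (Set.Icc (0 : ℝ) 1))
    (a b : ℝ) :
    winner w.toFun z (fun t => a * u t + b * v t) =
      a * winner w.toFun z u + b * winner w.toFun z v := by
  rw [w.winner_eq_cinner hz (by fun_prop), w.winner_eq_cinner hz hu, w.winner_eq_cinner hz hv,
    cinner_comm, cinner_comm _ (u ∘ w.invFun), cinner_comm _ (v ∘ w.invFun)]
  exact cinner_linear_left (w.continuousOn_comp_invFun hu) (w.continuousOn_comp_invFun hv)
    (w.continuousOn_comp_invFun hz) a b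

lemma winner_comp_eq_cinner {u v : ℝ → ℝ} (hu : ContinuousOn u (Set.Icc (0 : ℝ) 1))
    (hv : ContinuousOn v (Set.Icc (0 : ℝ) 1)) :
    winner w.toFun u (v ∘ w.toFun) = cinner (u ∘ w.invFun) v := by
  rw [w.winner_eq_cinner hu (w.continuousOn_comp_toFun hv)]
  refine cinner_congr (Set.eqOn_refl _ _) fun x hx => ?_
  simp only [Function.comp_apply, w.right_inv x hx]

lemma wnorm_eq_cnorm {u : ℝ → ℝ} (hu : ContinuousOn u (Set.Icc (0 : ℝ) 1)) :
    wnorm w.toFun u = cnorm (u ∘ w.invFun) := by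
  rw [wnorm, cnorm, w.winner_eq_cinner hu hu]

end Warp

/-- under (C1), (C2), (C4), (C6), `λ > 0`, `‖fⱼ∘ψⱼ‖ > 0` and
`‖f₁‖ⱼ > 0` for `2 ≤ j ≤ k`, one has
`Σⱼ r(f₁∘ψⱼ⁻¹, fⱼ) ≤ Σⱼ r((λf₁ + g₀)∘ψⱼ⁻¹, fⱼ)`. -/
theorem stmt_5 (k : ℕ) (hk : 2 ≤ k) (f : ℕ → ℝ → ℝ)
    (hf : ∀ j ∈ Finset.Icc 1 k, ContinuousOn (f j) (Set.Icc (0:ℝ) 1))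
    (w : ℕ → Warp)
    (θ : ℕ → ℝ) (hθ : ∀ j ∈ Finset.Icc 2 k, θ j ∈ Set.Icc (0:ℝ) 1)
    (hθsum : ∑ j ∈ Finset.Icc 2 k, θ j = 1)
    (lam : ℝ) (hlam : 0 < lam)
    (g₀ : ℝ → ℝ)
    (hg₀ : g₀ = fun t => ∑ j ∈ Finset.Icc 2 k,
      θ j * (f j ((w j).toFun t) / cnorm (f j ∘ (w j).toFun)))
    (A B D E α β : ℕ → ℝ)
    (hA : ∀ j ∈ Finset.Icc 2 k, A j =
      winner (w j).toFun (f 1) (f j ∘ (w j).toFun) / wnorm (w j).toFun (f 1))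
    (hB : ∀ j ∈ Finset.Icc 2 k, B j =
      winner (w j).toFun g₀ (f j ∘ (w j).toFun) / wnorm (w j).toFun (f 1))
    (hD : ∀ j ∈ Finset.Icc 2 k, D j =
      2 * winner (w j).toFun (f 1) g₀ / (wnorm (w j).toFun (f 1)) ^ 2)
    (hE : ∀ j ∈ Finset.Icc 2 k, E j =
      wnorm (w j).toFun g₀ / wnorm (w j).toFun (f 1))
    (hα : ∀ j ∈ Finset.Icc 2 k, α j = B j - (1 / 2) * A j * D j)
    (hβ : ∀ j ∈ Finset.Icc 2 k, β j =
      (1 / 2) * (A j * E j ^ 2 + B j * D j + |B j| * E j) +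
        (3 / Real.sqrt 2) * (|A j| + 1) * (|D j| + E j) ^ 2)
    (LC6 : ℝ)
    (hLC6 : LC6 = max ((∑ j ∈ Finset.Icc 2 k, β j) / (∑ j ∈ Finset.Icc 2 k, α j))
      ((Finset.Icc 2 k).sup' (Finset.nonempty_Icc.mpr hk) fun j => max (E j) |B j|))
    (hC1 : ∀ j ∈ Finset.Icc 1 k, cnorm (f j) = 1)
    (hC2 : ∀ j ∈ Finset.Icc 2 k, 0 ≤ cinner (f 1) (f j ∘ (w j).toFun))
    (hC4 : 0 < ∑ l ∈ Finset.Icc 2 k, winner (w l).toFun g₀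
      (fun t => (1 / wnorm (w l).toFun (f 1)) *
        (f l ((w l).toFun t) -
          winner (w l).toFun (f l ∘ (w l).toFun) (f 1) * f 1 t /
            (wnorm (w l).toFun (f 1)) ^ 2)))
    (hC6 : lam ≥ LC6)
    (hpos : ∀ j ∈ Finset.Icc 2 k, 0 < cnorm (f j ∘ (w j).toFun))
    (hpos1 : ∀ j ∈ Finset.Icc 2 k, 0 < wnorm (w j).toFun (f 1)) :
    ∑ j ∈ Finset.Icc 2 k, csim (f 1 ∘ (w j).invFun) (f j) ≤
      ∑ j ∈ Finset.Icc 2 k,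
        csim ((fun t => lam * f 1 t + g₀ t) ∘ (w j).invFun) (f j) := by
  have hmem : ∀ j ∈ Finset.Icc 2 k, j ∈ Finset.Icc 1 k := fun j hj => by
    simp only [Finset.mem_Icc] at hj ⊢
    omega
  have h1 : ContinuousOn (f 1) (Set.Icc (0 : ℝ) 1) := hf 1 (by simp; omega)
  have hcomp : ∀ j ∈ Finset.Icc 2 k,
      ContinuousOn (f j ∘ (w j).toFun) (Set.Icc (0 : ℝ) 1) :=
    fun j hj => (w j).continuousOn_comp_toFun (hf j (hmem j hj))
  have hg : ContinuousOn g₀ (Set.Icc (0 : ℝ) 1) := by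
    rw [hg₀]
    exact continuousOn_finsetSum _ fun j hj =>
      continuousOn_const.mul ((hcomp j hj).div_const _)
  have hαsum : 0 < ∑ j ∈ Finset.Icc 2 k, α j := by
    refine hC4.trans_eq (Finset.sum_congr rfl fun l hl => ?_)
    have hN : wnorm (w l).toFun (f 1) ≠ 0 := (hpos1 l hl).ne'
    have hfun : (fun t => (1 / wnorm (w l).toFun (f 1)) * (f l ((w l).toFun t) -
          winner (w l).toFun (f l ∘ (w l).toFun) (f 1) * f 1 t / wnorm (w l).toFun (f 1) ^ 2)) =
        fun t => 1 / wnorm (w l).toFun (f 1) * (f l ∘ (w l).toFun) t +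
          -(winner (w l).toFun (f l ∘ (w l).toFun) (f 1) / wnorm (w l).toFun (f 1) ^ 3) * f 1 t := by
      funext t
      simp only [Function.comp_apply]
      field_simp
      ring
    rw [hfun, (w l).winner_linear_right hg (hcomp l hl) h1, hα l hl, hA l hl, hB l hl, hD l hl,
      winner_comm_s5 _ (f l ∘ _), winner_comm_s5 _ g₀ (f 1)]
    field_simp
    ring
  have hβlam : ∑ j ∈ Finset.Icc 2 k, β j ≤ lam * ∑ j ∈ Finset.Icc 2 k, α j := by
    rw [← div_le_iff₀ hαsum]
    exact (le_max_left _ _).trans (hLC6 ▸ hC6)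
  have hterm : ∀ j ∈ Finset.Icc 2 k,
      csim (f 1 ∘ (w j).invFun) (f j) + (lam * α j - β j) / lam ^ 2 ≤
        csim ((fun t => lam * f 1 t + g₀ t) ∘ (w j).invFun) (f j) := by
    intro j hj
    have hfj := hf j (hmem j hj)
    have hmax : max (E j) |B j| ≤ lam := by
      refine le_trans ?_ ((le_max_right _ _).trans (hLC6 ▸ hC6))
      exact Finset.le_sup' (fun j => max (E j) |B j|) hj
    rw [hα j hj, hβ j hj]
    refine le_csim_linear ((w j).continuousOn_comp_invFun h1)
      ((w j).continuousOn_comp_invFun hg) hfj (hC1 j (hmem j hj)) ?_ hlam ?_ ?_ ?_ ?_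
      ((le_max_left _ _).trans hmax) ((le_max_right _ _).trans hmax)
    · rw [← (w j).wnorm_eq_cnorm h1]
      exact hpos1 j hj
    · rw [hA j hj, (w j).winner_comp_eq_cinner h1 hfj, (w j).wnorm_eq_cnorm h1]
    · rw [hB j hj, (w j).winner_comp_eq_cinner hg hfj, (w j).wnorm_eq_cnorm h1]
    · rw [hD j hj, (w j).winner_eq_cinner h1 hg, (w j).wnorm_eq_cnorm h1]
    · rw [hE j hj, (w j).wnorm_eq_cnorm hg, (w j).wnorm_eq_cnorm h1]
  refine le_trans ?_ (Finset.sum_le_sum hterm)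
  rw [Finset.sum_add_distrib, ← Finset.sum_div, Finset.sum_sub_distrib, ← Finset.mul_sum]
  exact le_add_of_nonneg_right (div_nonneg (sub_nonneg.mpr hβlam) (sq_nonneg lam))
end
end
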